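/- In the first-price auction subgame against the speculator's equilibrium mixed strategy, it is optimal for a seller with value v to bid β(v; m, v⋆): for every v ∈ [v⋆, b̄(m,v⋆)) and every v̂ ∈ [v⋆, b̄(m,v⋆)), the deviation payoff ϖ(v̂; v) := (1 − G(v̂;v⋆))^{m−1} · exp(−Λ(v̂)) · (β(v̂; m, v⋆) − v) satisfies ϖ(v̂; v) ≤ ϖ(v; v), where Λ(v̂) := ∫_{v⋆}^{v̂} [β(x; m, v⋆) + (m−1)x] f(x) / ([β(x; m, v⋆) − x] (1 − F(x))) dx. -/

import Mathlib

open MeasureTheory Set Real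

/-- Truncated conditional CDF `G(x; v⋆) = (F x − F v⋆)/(1 − F v⋆)`. -/
noncomputable def G (F : ℝ → ℝ) (vs x : ℝ) : ℝ := (F x - F vs) / (1 - F vs)

/-- `ubar_b(m, v⋆) = max_{b ∈ [v⋆, r]} b (1 − G(b; v⋆))^m`. -/
noncomputable def ubarb (F : ℝ → ℝ) (r : ℝ) (m : ℕ) (vs : ℝ) : ℝ :=
  sSup ((fun b => b * (1 - G F vs b) ^ m) '' Icc vs r)

/-- `b̄(m, v⋆)`: the smallest maximizer of `b (1 − G(b; v⋆))^m` over `[v⋆, r]`. -/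
noncomputable def bbar (F : ℝ → ℝ) (r : ℝ) (m : ℕ) (vs : ℝ) : ℝ :=
  sInf {b ∈ Icc vs r | b * (1 - G F vs b) ^ m = ubarb F r m vs}

/-- Sellers' equilibrium bid function on `[v⋆, b̄(m, v⋆)]`. -/
noncomputable def beta (F : ℝ → ℝ) (r : ℝ) (m : ℕ) (vs : ℝ) (v : ℝ) : ℝ :=
  ubarb F r m vs / (1 - G F vs v) ^ m

/-- Exponent `Λ(v̂)` so that `exp (−Λ(v̂)) = 1 − Ψ(β(v̂; m, v⋆))`, where `Ψ` is the CDF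
of the speculator's equilibrium mixed bid. -/
noncomputable def Lam (F f : ℝ → ℝ) (r : ℝ) (m : ℕ) (vs : ℝ) (vhat : ℝ) : ℝ :=
  ∫ x in vs..vhat,
    (beta F r m vs x + ((m : ℝ) - 1) * x) * f x /
      ((beta F r m vs x - x) * (1 - F x))

/-- A seller of value `v` who bids as if of type `v̂` gets expected payoff `ϖ(v̂; v)`. -/
noncomputable def payoff (F f : ℝ → ℝ) (r : ℝ) (m : ℕ) (vs : ℝ) (vhat v : ℝ) : ℝ :=
  (1 - G F vs vhat) ^ (m - 1) * Real.exp (-Lam F f r m vs vhat) *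
    (beta F r m vs vhat - v)

/-- Bidding `β(v; m, v⋆)` is optimal for a seller of value `v` against the speculator's
equilibrium mixed strategy. -/
theorem beta_is_best_response
    (F f : ℝ → ℝ) (N : ℕ) (hN : 2 ≤ N)
    (hderiv : ∀ x ∈ Icc (0 : ℝ) 1, HasDerivAt F (f x) x)
    (hfc : ContinuousOn f (Icc 0 1))
    (hfpos : ∀ x ∈ Ioo (0 : ℝ) 1, 0 < f x)
    (hF0 : F 0 = 0) (hF1 : F 1 = 1)
    (r : ℝ) (hr : r ∈ Ioc (0 : ℝ) 1)
    (m : ℕ) (hm : 1 ≤ m)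
    (vs : ℝ) (hvs : vs ∈ Ico (0 : ℝ) r) (hFvs : F vs < 1) :
    ∀ v ∈ Ico vs (bbar F r m vs), ∀ vhat ∈ Ico vs (bbar F r m vs),
      payoff F f r m vs vhat v ≤ payoff F f r m vs v v := by
  obtain ⟨hr0, hr1⟩ := hr
  obtain ⟨hvs0, hvsr⟩ := hvs
  have hD : 0 < 1 - F vs := by linarith
  have hFcont : ContinuousOn F (Icc 0 1) :=
    fun x hx => (hderiv x hx).continuousAt.continuousWithinAt
  have hmono : StrictMonoOn F (Icc 0 1) := by
    apply strictMonoOn_of_deriv_pos (convex_Icc 0 1) hFcont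
    intro x hx
    rw [interior_Icc] at hx
    rw [(hderiv x (Ioo_subset_Icc_self hx)).deriv]
    exact hfpos x hx
  have hFlt : ∀ x, 0 ≤ x → x < 1 → 0 < 1 - F x := by
    intro x h0 h1
    have := hmono ⟨h0, h1.le⟩ (right_mem_Icc.2 zero_le_one) h1
    linarith
  have hS : ∀ x, 1 - G F vs x = (1 - F x) / (1 - F vs) := by
    intro x
    unfold G
    field_simp
    ring
  set B := bbar F r m vs with hB
  set u := ubarb F r m vs with hu
  have hBr : B ≤ r := by
    rw [hB]
    unfold bbar
    rcases Set.eq_empty_or_nonempty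
      {b ∈ Icc vs r | b * (1 - G F vs b) ^ m = ubarb F r m vs} with h | ⟨b, hb⟩
    · rw [h, Real.sInf_empty]; exact hr0.le
    · exact (csInf_le ⟨vs, fun y hy => hy.1.1⟩ hb).trans hb.1.2
  have hbdd : BddAbove ((fun b => b * (1 - G F vs b) ^ m) '' Icc vs r) := by
    apply IsCompact.bddAbove
    apply isCompact_Icc.image_of_continuousOn
    have hF' : ContinuousOn F (Icc vs r) := hFcont.mono (Icc_subset_Icc hvs0 hr1)
    unfold G
    fun_prop
  have hlt : ∀ x ∈ Ico vs B, x * (1 - G F vs x) ^ m < u := by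
    intro x hx
    have hxm : x ∈ Icc vs r := ⟨hx.1, hx.2.le.trans hBr⟩
    have hle : x * (1 - G F vs x) ^ m ≤ u := le_csSup hbdd ⟨x, hxm, rfl⟩
    refine lt_of_le_of_ne hle fun heq => ?_
    have : B ≤ x := csInf_le ⟨vs, fun y hy => hy.1.1⟩ ⟨hxm, heq⟩
    exact absurd hx.2 (not_lt.2 this)
  have hx01 : ∀ x ∈ Ico vs B, 0 ≤ x ∧ x < 1 := fun x hx =>
    ⟨hvs0.trans hx.1, hx.2.trans_le (hBr.trans hr1)⟩
  have hFp : ∀ x ∈ Ico vs B, 0 < 1 - F x := fun x hx =>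
    hFlt x (hx01 x hx).1 (hx01 x hx).2
  have hSp : ∀ x ∈ Ico vs B, 0 < 1 - G F vs x := fun x hx => by
    rw [hS]; exact div_pos (hFp x hx) hD
  have hb : ∀ x ∈ Ico vs B, x < beta F r m vs x := fun x hx => by
    unfold beta
    rw [lt_div_iff₀ (pow_pos (hSp x hx) m)]
    exact hlt x hx
  have hFc : ContinuousOn F (Ico vs B) := hFcont.mono fun x hx => 
    ⟨(hx01 x hx).1, (hx01 x hx).2.le⟩
  have hfc' : ContinuousOn f (Ico vs B) := hfc.mono fun x hx => 
    ⟨(hx01 x hx).1, (hx01 x hx).2.le⟩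
  have hGc : ContinuousOn (fun x => 1 - G F vs x) (Ico vs B) := by
    unfold G
    fun_prop
  have hbc : ContinuousOn (fun x => beta F r m vs x) (Ico vs B) := by
    unfold beta
    exact continuousOn_const.div (hGc.pow m) fun x hx => (pow_pos (hSp x hx) m).ne'
  set q : ℝ → ℝ := fun x => (beta F r m vs x + ((m : ℝ) - 1) * x) * f x /
      ((beta F r m vs x - x) * (1 - F x)) with hq
  have hqc : ContinuousOn q (Ico vs B) := by
    rw [hq]
    apply ContinuousOn.div
    · fun_prop
    · fun_prop
    · intro x hx
      exact (mul_pos (sub_pos.2 (hb x hx)) (hFp x hx)).ne'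
  have hLd : ∀ x ∈ Ioo vs B, HasDerivAt (Lam F f r m vs) (q x) x := by
    intro x hx
    have hsub : Icc vs x ⊆ Ico vs B := fun y hy => ⟨hy.1, hy.2.trans_lt hx.2⟩
    have hnhds : Ico vs B ∈ nhds x := Ico_mem_nhds hx.1 hx.2
    apply intervalIntegral.integral_hasDerivAt_right
    · apply ContinuousOn.intervalIntegrable
      rw [uIcc_of_le hx.1.le]
      exact hqc.mono hsub
    · exact (hqc.mono Ioo_subset_Ico_self).stronglyMeasurableAtFilter isOpen_Ioo x hx
    · exact hqc.continuousAt hnhds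
  have hLc : ∀ c ∈ Ico vs B, ContinuousOn (Lam F f r m vs) (Icc vs c) := by
    intro c hc
    have hsub : Icc vs c ⊆ Ico vs B := fun y hy => ⟨hy.1, hy.2.trans_lt hc.2⟩
    have h := intervalIntegral.continuousOn_primitive_interval (μ := volume) (f := q)
      (a := vs) (b := c)
    rw [uIcc_of_le hc.1] at h
    exact h ((hqc.mono hsub).integrableOn_compact isCompact_Icc)
  intro v hv
  have hPc : ∀ c ∈ Ico vs B, ContinuousOn (fun x => payoff F f r m vs x v) (Icc vs c) := by
    intro c hc
    have hsub : Icc vs c ⊆ Ico vs B := fun y hy => ⟨hy.1, hy.2.trans_lt hc.2⟩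
    have h1 := hLc c hc
    have h2 := hGc.mono hsub
    have h3 := hbc.mono hsub
    unfold payoff
    exact ((h2.pow _).mul (Real.continuous_exp.comp_continuousOn h1.neg)).mul
      (h3.sub continuousOn_const)
  have hPd : ∀ x ∈ Ioo vs B, ∃ C : ℝ, 0 ≤ C ∧
      HasDerivAt (fun x => payoff F f r m vs x v) (C * (v - x)) x := by
    intro x hx
    have hx' : x ∈ Ico vs B := Ioo_subset_Ico_self hx
    have hxI := hx01 x hx'
    have hx0 : 0 < x := hvs0.trans_lt hx.1
    have hf0 : 0 < f x := hfpos x ⟨hx0, hxI.2⟩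
    have hSx := hSp x hx'
    have hFx := hFp x hx'
    have hbx := hb x hx'
    have hb0 : 0 < beta F r m vs x := hx0.trans hbx
    have hsd : HasDerivAt (fun x => 1 - G F vs x) (-(f x / (1 - F vs))) x := by
      unfold G
      exact (((hderiv x ⟨hxI.1, hxI.2.le⟩).sub_const _).div_const _).const_sub 1
    have hsf : f x / (1 - F vs) = (1 - G F vs x) * (f x / (1 - F x)) := by
      rw [hS]; field_simp
    rw [hsf] at hsd
    obtain ⟨k, rfl⟩ : ∃ k, m = k + 1 := ⟨m - 1, by omega⟩
    set s := 1 - G F vs x with hs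
    set h := f x / (1 - F x) with hh
    have hh0 : 0 < h := div_pos hf0 hFx
    have hbd : HasDerivAt (fun x => beta F r (k+1) vs x)
        (((k : ℝ) + 1) * beta F r (k+1) vs x * h) x := by
      have := ((hasDerivAt_const x (ubarb F r (k+1) vs)).div (hsd.pow (k+1))
        (pow_pos hSx (k+1)).ne')
      unfold beta
      refine this.congr_deriv ?_
      simp only [Pi.pow_apply, ← hs]
      push_cast
      try simp only [Nat.add_sub_cancel]
      field_simp
      ring
    have hpd : HasDerivAt (fun x => (1 - G F vs x) ^ k) (-((k : ℝ) * s ^ k * h)) x := by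
      refine (hsd.pow k).congr_deriv ?_
      rcases k with _ | k
      · simp
      · simp only [Nat.add_sub_cancel, ← hs]
        ring
    have hqx : q x = (beta F r (k+1) vs x + k * x) * h / (beta F r (k+1) vs x - x) := by
      rw [hq, hh]
      have : beta F r (k+1) vs x - x ≠ 0 := (sub_pos.2 hbx).ne'
      push_cast
      field_simp
      ring
    have hL := (hLd x hx).neg.exp
    rw [hqx] at hL
    refine ⟨s ^ k * Real.exp (-Lam F f r (k+1) vs x) * h * (k + 1) * beta F r (k+1) vs x /
      (beta F r (k+1) vs x - x), ?_, ?_⟩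
    · have := sub_pos.2 hbx
      positivity
    · unfold payoff
      simp only [Nat.add_sub_cancel]
      refine ((hpd.mul hL).mul (hbd.sub_const v)).congr_deriv ?_
      have : beta F r (k+1) vs x - x ≠ 0 := (sub_pos.2 hbx).ne'
      simp only [Pi.mul_apply, Pi.neg_apply, ← hs]
      field_simp
      ring
  intro w hw
  rcases le_total w v with hwv | hwv
  · have hm : MonotoneOn (fun x => payoff F f r m vs x v) (Icc vs v) := by
      apply monotoneOn_of_deriv_nonneg (convex_Icc _ _) (hPc v hv)
      · intro x hx
        rw [interior_Icc] at hx
        obtain ⟨C, _, hC⟩ := hPd x ⟨hx.1, hx.2.trans hv.2⟩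
        exact hC.differentiableAt.differentiableWithinAt
      · intro x hx
        rw [interior_Icc] at hx
        obtain ⟨C, hC0, hC⟩ := hPd x ⟨hx.1, hx.2.trans hv.2⟩
        rw [hC.deriv]
        exact mul_nonneg hC0 (by linarith [hx.2])
    exact hm ⟨hw.1, hwv⟩ ⟨hv.1, le_rfl⟩ hwv
  · have hm : AntitoneOn (fun x => payoff F f r m vs x v) (Icc v w) := by
      apply antitoneOn_of_deriv_nonpos (convex_Icc _ _)
        ((hPc w hw).mono (Icc_subset_Icc_left hv.1))
      · intro x hx
        rw [interior_Icc] at hx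
        obtain ⟨C, _, hC⟩ := hPd x ⟨hv.1.trans_lt hx.1, hx.2.trans hw.2⟩
        exact hC.differentiableAt.differentiableWithinAt
      · intro x hx
        rw [interior_Icc] at hx
        obtain ⟨C, hC0, hC⟩ := hPd x ⟨hv.1.trans_lt hx.1, hx.2.trans hw.2⟩
        rw [hC.deriv]
        exact mul_nonpos_of_nonneg_of_nonpos hC0 (by linarith [hx.1])
    exact hm ⟨le_rfl, hwv⟩ ⟨hwv, le_rfl⟩ hwv
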